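/- arXiv:1501.02994 — 5 statements merged into one kernel-verified Lean document; each statement's English description precedes it below -/
import Mathlib

section
/- For every z ∈ ℂ* the series Σ_{ℓ∈ℤ} q^{−ℓ(ℓ+1)/2} z^ℓ converges absolutely, the infinite product Π_{ℓ=0}^{∞} (1 − q^{−ℓ−1})(1 + q^{−ℓ−1}z)(1 + q^{−ℓ}z^{−1}) converges, and the two are equal (Jacobi triple product form of the theta function Θ_q). -/
/-- The theta function `Θ_Q(z) = Σ_{ℓ ∈ ℤ} Q^(-ℓ(ℓ+1)/2) z^ℓ`. -/
noncomputable def theta (Q z : ℂ) : ℂ := ∑' ℓ : ℤ, Q ^ (-(ℓ * (ℓ + 1)) / 2) * z ^ ℓ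

open Filter Topology

/-- The finite `q`-Pochhammer symbol `∏_{i=1}^n (1 - p^i)`. -/
noncomputable def qPoch (p : ℂ) (n : ℕ) : ℂ := ∏ i ∈ Finset.range n, (1 - p ^ (i + 1))

/-- The reciprocal of `qPoch`, extended by zero to negative integers. -/
noncomputable def qPochInv (p : ℂ) (m : ℤ) : ℂ := if m < 0 then 0 else (qPoch p m.toNat)⁻¹

section

variable {p : ℂ}

lemma one_sub_pow_succ_ne_zero (hp : ‖p‖ < 1) (n : ℕ) : 1 - p ^ (n + 1) ≠ 0 := by
  intro h
  have h1 : ‖p ^ (n + 1)‖ < 1 := by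
    rw [norm_pow]
    exact pow_lt_one₀ (norm_nonneg _) hp n.succ_ne_zero
  rw [← sub_eq_zero.1 h] at h1
  simp at h1

lemma qPochInv_natCast (n : ℕ) : qPochInv p n = (qPoch p n)⁻¹ := by simp [qPochInv]

lemma qPochInv_of_neg {m : ℤ} (hm : m < 0) : qPochInv p m = 0 := if_pos hm

lemma qPochInv_sub_one (hp : ‖p‖ < 1) (m : ℤ) :
    qPochInv p (m - 1) = (1 - p ^ m) * qPochInv p m := by
  rcases lt_trichotomy m 0 with hm | rfl | hm
  · rw [qPochInv_of_neg hm, qPochInv_of_neg (by lia), mul_zero]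
  · rw [qPochInv_of_neg (by lia)]
    simp
  · obtain ⟨n, rfl⟩ : ∃ n : ℕ, m = (n + 1 : ℕ) := ⟨(m - 1).toNat, by lia⟩
    rw [qPochInv_natCast, show ((n + 1 : ℕ) : ℤ) - 1 = n by lia, qPochInv_natCast, zpow_natCast,
      qPoch, qPoch, Finset.prod_range_succ, mul_inv, mul_left_comm,
      mul_inv_cancel₀ (one_sub_pow_succ_ne_zero hp n), mul_one]

lemma summable_norm_geometric_mul (hp : ‖p‖ < 1) (c : ℂ) :
    Summable fun n : ℕ => ‖p ^ n * c‖ := by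
  simpa only [norm_mul, norm_pow] using
    (summable_geometric_of_lt_one (norm_nonneg p) hp).mul_right ‖c‖

lemma multipliable_one_add_pow_mul (hp : ‖p‖ < 1) (c : ℂ) :
    Multipliable fun n : ℕ => 1 + p ^ n * c :=
  multipliable_one_add_of_summable (summable_norm_geometric_mul hp c)

lemma multipliable_one_sub_pow_succ (hp : ‖p‖ < 1) :
    Multipliable fun n : ℕ => 1 - p ^ (n + 1) := by
  simpa only [pow_succ, mul_neg, ← sub_eq_add_neg] using multipliable_one_add_pow_mul hp (-p)

lemma exists_tendsto_qPoch (hp : ‖p‖ < 1) :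
    ∃ L : ℂ, L ≠ 0 ∧ Tendsto (qPoch p) atTop (𝓝 L) := by
  refine ⟨_, ?_, (multipliable_one_sub_pow_succ hp).hasProd.tendsto_prod_nat⟩
  have h := tprod_one_add_ne_zero_of_summable (f := fun n : ℕ => p ^ n * (-p))
    (fun n => by simpa only [pow_succ, mul_neg, ← sub_eq_add_neg] using
      one_sub_pow_succ_ne_zero hp n) (summable_norm_geometric_mul hp (-p))
  simpa only [pow_succ, mul_neg, ← sub_eq_add_neg] using h

lemma tendsto_qPochInv {L : ℂ} (hL : L ≠ 0) (h : Tendsto (qPoch p) atTop (𝓝 L)) :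
    Tendsto (qPochInv p) atTop (𝓝 L⁻¹) := by
  have hnat : Tendsto (fun m : ℤ => m.toNat) atTop atTop :=
    tendsto_atTop.2 fun b => (eventually_ge_atTop (b : ℤ)).mono fun m hm => by lia
  refine ((h.inv₀ hL).comp hnat).congr' ?_
  filter_upwards [eventually_ge_atTop 0] with m hm
  simp [qPochInv, not_lt.2 hm]

lemma exists_norm_qPoch_le {L : ℂ} (h : Tendsto (qPoch p) atTop (𝓝 L)) :
    ∃ C, ∀ n, ‖qPoch p n‖ ≤ C := by
  obtain ⟨C, hC⟩ := (Metric.isBounded_range_of_tendsto _ h).exists_norm_le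
  exact ⟨C, fun n => hC _ ⟨n, rfl⟩⟩

lemma exists_norm_qPochInv_le {L : ℂ} (hL : L ≠ 0) (h : Tendsto (qPoch p) atTop (𝓝 L)) :
    ∃ C, ∀ m, ‖qPochInv p m‖ ≤ C := by
  obtain ⟨C, hC⟩ := (Metric.isBounded_range_of_tendsto _ (h.inv₀ hL)).exists_norm_le
  refine ⟨C, fun m => ?_⟩
  rcases lt_or_ge m 0 with hm | hm
  · rw [qPochInv_of_neg hm, norm_zero]
    exact (norm_nonneg _).trans (hC _ ⟨0, rfl⟩)
  · lift m to ℕ using hm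
    rw [qPochInv_natCast]
    exact hC _ ⟨m, rfl⟩

variable {z : ℂ} {w : ℤ → ℂ}

/-- The finite form of the Jacobi triple product: a two-sided `q`-binomial theorem. -/
lemma hasSum_finite_jacobi (hp : ‖p‖ < 1) (hp0 : p ≠ 0) (hz : z ≠ 0) (hw0 : w 0 = 1)
    (hw : ∀ k, w (k + 1) = w k * p ^ (k + 1) * z) (n : ℕ) :
    HasSum (fun k : ℤ => qPoch p (2 * n) * qPochInv p (n + k) * qPochInv p (n - k) * w k)
      (∏ i ∈ Finset.range n, (1 + p ^ (i + 1) * z) * (1 + p ^ i * z⁻¹)) := by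
  induction n with
  | zero =>
    convert hasSum_single (0 : ℤ) ?_ using 1
    · simp [hw0, qPochInv, qPoch]
    · intro k hk
      rcases lt_or_gt_of_ne hk with hk | hk
      · simp [qPochInv_of_neg hk]
      · simp [qPochInv_of_neg (neg_lt_zero.2 hk)]
  | succ n ih =>
    have hprev := (Equiv.subRight (1 : ℤ)).hasSum_iff.2 ih
    have hnext := (Equiv.addRight (1 : ℤ)).hasSum_iff.2 ih
    rw [Finset.prod_range_succ, mul_comm (Finset.prod _ _)]
    have key := ((ih.mul_left (1 + p ^ (2 * n + 1))).add (hprev.mul_left (p ^ (n + 1) * z))).add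
      (hnext.mul_left (p ^ n * z⁻¹))
    rw [← add_mul, ← add_mul, show 1 + p ^ (2 * n + 1) + p ^ (n + 1) * z + p ^ n * z⁻¹ =
      (1 + p ^ (n + 1) * z) * (1 + p ^ n * z⁻¹) by field_simp; ring] at key
    refine (congrArg (HasSum · _) (funext fun k => ?_)).mpr key
    have hk := hw (k - 1)
    rw [sub_add_cancel] at hk
    have hplus := qPochInv_sub_one hp (n + 1 + k)
    have hplus' := qPochInv_sub_one hp (n + k)
    have hminus := qPochInv_sub_one hp (n + 1 - k)
    have hminus' := qPochInv_sub_one hp (n - k)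
    rw [show (n : ℤ) + 1 + k - 1 = n + k by ring] at hplus
    rw [show (n : ℤ) + 1 - k - 1 = n - k by ring] at hminus
    have hP : qPoch p (2 * (n + 1)) =
        qPoch p (2 * n) * (1 - p ^ (2 * n + 1)) * (1 - p ^ (2 * n + 2)) := by
      rw [qPoch, mul_add, mul_one, Finset.prod_range_succ, Finset.prod_range_succ, qPoch]
    simp only [Function.comp_apply, Equiv.subRight_apply, Equiv.coe_addRight, Nat.cast_add,
      Nat.cast_one]
    rw [show (n : ℤ) + (k - 1) = n + k - 1 by ring, show (n : ℤ) - (k - 1) = n + 1 - k by ring,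
      show (n : ℤ) + (k + 1) = n + 1 + k by ring, show (n : ℤ) - (k + 1) = n - k - 1 by ring,
      hplus', hminus', hplus, hminus, hP, hw k, hk]
    simp only [zpow_add₀ hp0, zpow_sub₀ hp0, zpow_natCast, zpow_one]
    have hY : p ^ k ≠ 0 := zpow_ne_zero _ hp0
    generalize p ^ k = Y at hY
    field_simp
    ring

lemma summable_norm_of_recurrence (hp : ‖p‖ < 1) (hp0 : p ≠ 0) (hz : z ≠ 0)
    (hne : ∀ k, w k ≠ 0) (hw : ∀ k, w (k + 1) = w k * p ^ (k + 1) * z) :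
    Summable fun k : ℤ => ‖w k‖ := by
  have hlim (c : ℂ) : Tendsto (fun n : ℕ => ‖p ^ (n + 1) * c‖) atTop (𝓝 0) := by
    have h := ((tendsto_pow_atTop_nhds_zero_of_norm_lt_one hp).comp (tendsto_add_atTop_nat 1))
    simpa using (h.mul_const c).norm
  apply Summable.of_nat_of_neg_add_one
  · refine summable_of_ratio_test_tendsto_lt_one zero_lt_one
      (.of_forall fun n => norm_ne_zero_iff.2 (hne _)) ((hlim z).congr fun n => ?_)
    have := norm_ne_zero_iff.2 (hne n)
    rw [norm_norm, norm_norm, ← norm_div]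
    push_cast
    rw [hw]
    congr 1
    have := hne n
    field_simp
    norm_cast
  · refine summable_of_ratio_test_tendsto_lt_one zero_lt_one
      (.of_forall fun n => norm_ne_zero_iff.2 (hne _)) ((hlim z⁻¹).congr fun n => ?_)
    have h := hw (-((n + 1 : ℕ) + 1))
    rw [show -(((n + 1 : ℕ) : ℤ) + 1) + 1 = -((n : ℤ) + 1) by push_cast; ring, zpow_neg] at h
    rw [norm_norm, norm_norm, ← norm_div, h]
    congr 1
    have := hne (-((n + 1 : ℕ) + 1))
    have hpow : p ^ ((n : ℤ) + 1) = p ^ (n + 1) := by norm_cast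
    rw [hpow]
    field_simp

/-- The Jacobi triple product as the limit of its finite forms. -/
lemma hasProd_jacobi (hp : ‖p‖ < 1) (hp0 : p ≠ 0) (hz : z ≠ 0) (hw0 : w 0 = 1)
    (hw : ∀ k, w (k + 1) = w k * p ^ (k + 1) * z) (hsum : Summable fun k : ℤ => ‖w k‖) :
    HasProd (fun n : ℕ => (1 - p ^ (n + 1)) * (1 + p ^ (n + 1) * z) * (1 + p ^ n * z⁻¹))
      (∑' k, w k) := by
  have hmul : Multipliable
      fun n : ℕ => (1 - p ^ (n + 1)) * (1 + p ^ (n + 1) * z) * (1 + p ^ n * z⁻¹) := by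
    refine ((multipliable_one_sub_pow_succ hp).mul ?_).mul (multipliable_one_add_pow_mul hp z⁻¹)
    simpa only [pow_succ, mul_assoc] using multipliable_one_add_pow_mul hp (p * z)
  obtain ⟨L, hL, hPL⟩ := exists_tendsto_qPoch hp
  obtain ⟨C, hC⟩ := exists_norm_qPoch_le hPL
  obtain ⟨D, hD⟩ := exists_norm_qPochInv_le hL hPL
  have hC0 : 0 ≤ C := (norm_nonneg _).trans (hC 0)
  have hD0 : 0 ≤ D := (norm_nonneg _).trans (hD 0)
  have hR := tendsto_qPochInv hL hPL
  have hcast : Tendsto (fun n : ℕ => (n : ℤ)) atTop atTop := tendsto_natCast_atTop_atTop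
  have hdouble : Tendsto (fun n : ℕ => 2 * n) atTop atTop :=
    tendsto_id.const_mul_atTop' two_pos
  have hlim : Tendsto (fun n : ℕ => ∑' k : ℤ, qPoch p n *
      (qPoch p (2 * n) * qPochInv p (n + k) * qPochInv p (n - k) * w k)) atTop
      (𝓝 (∑' k, w k)) := by
    refine tendsto_tsum_of_dominated_convergence (hsum.mul_left (C * (C * D * D))) (fun k => ?_)
      (.of_forall fun n k => ?_)
    · have h := hPL.mul ((((hPL.comp hdouble).mul
        (hR.comp (tendsto_atTop_add_const_right _ k hcast))).mul
        (hR.comp (tendsto_atTop_add_const_right _ (-k) hcast))).mul_const (w k))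
      have hLw : L * (L * L⁻¹ * L⁻¹ * w k) = w k := by field_simp
      rw [hLw] at h
      exact h
    · rw [norm_mul, norm_mul, norm_mul, norm_mul, mul_assoc C]
      gcongr <;> first | exact hC _ | exact hD _
  refine (tendsto_nhds_unique hmul.hasProd.tendsto_prod_nat (hlim.congr fun n => ?_)) ▸
    hmul.hasProd
  rw [((hasSum_finite_jacobi hp hp0 hz hw0 hw n).mul_left _).tsum_eq, qPoch,
    ← Finset.prod_mul_distrib]
  simp only [mul_assoc]

end

lemma neg_triangular_succ (k : ℤ) :
    -((k + 1) * (k + 1 + 1)) / 2 = -(k * (k + 1)) / 2 + -(k + 1) := by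
  rw [← Int.add_mul_ediv_right _ _ two_ne_zero]
  ring_nf

/-- For `|q| > 1` and `z ≠ 0`, the theta series converges absolutely, the Jacobi
triple product converges, and the two agree. -/
theorem jacobi_triple_product (q : ℂ) (hq : 1 < ‖q‖) (z : ℂ) (hz : z ≠ 0) :
    Summable (fun ℓ : ℤ => ‖q ^ (-(ℓ * (ℓ + 1)) / 2) * z ^ ℓ‖) ∧
    Multipliable (fun ℓ : ℕ =>
      (1 - q ^ (-(ℓ : ℤ) - 1)) * (1 + q ^ (-(ℓ : ℤ) - 1) * z) * (1 + q ^ (-(ℓ : ℤ)) * z⁻¹)) ∧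
    theta q z = ∏' ℓ : ℕ,
      (1 - q ^ (-(ℓ : ℤ) - 1)) * (1 + q ^ (-(ℓ : ℤ) - 1) * z) * (1 + q ^ (-(ℓ : ℤ)) * z⁻¹) := by
  have hq0 : q ≠ 0 := norm_pos_iff.1 (zero_lt_one.trans hq)
  have hp : ‖q⁻¹‖ < 1 := by rw [norm_inv]; exact inv_lt_one_of_one_lt₀ hq
  have hw (k : ℤ) : q ^ (-((k + 1) * (k + 1 + 1)) / 2) * z ^ (k + 1) =
      q ^ (-(k * (k + 1)) / 2) * z ^ k * q⁻¹ ^ (k + 1) * z := by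
    rw [neg_triangular_succ, zpow_add₀ hq0, zpow_add_one₀ hz, inv_zpow']
    ring
  have hsum := summable_norm_of_recurrence (w := fun k => q ^ (-(k * (k + 1)) / 2) * z ^ k)
    hp (inv_ne_zero hq0) hz
    (fun k => mul_ne_zero (zpow_ne_zero _ hq0) (zpow_ne_zero _ hz)) hw
  have hprod := hasProd_jacobi hp (inv_ne_zero hq0) hz (by simp) hw hsum
  have hfac (n : ℕ) : q⁻¹ ^ (n + 1) = q ^ (-(n : ℤ) - 1) := by
    rw [← zpow_natCast, inv_zpow']
    push_cast
    ring_nf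
  have hfac' (n : ℕ) : q⁻¹ ^ n = q ^ (-(n : ℤ)) := by rw [← zpow_natCast, inv_zpow']
  simp only [hfac, hfac'] at hprod
  exact ⟨hsum, hprod.multipliable, hprod.tprod_eq.symm⟩
end

section
/- Let n, d be positive coprime integers, μ := n/d, and λ ∈ ℂ*. Let g be a complex-valued function defined at the points q^ℓλ for all ℓ ∈ dℤ, and suppose that for some z ∈ ℂ* ∖ (−λq^{dℤ}) both bilateral series Σ_{ℓ∈dℤ} g(q^ℓλ)/Θ_{q^d}(q^{d+ℓ}λ/z) and Σ_{ℓ∈dℤ} q^ℓλ·g(q^ℓλ)/Θ_{q^d}(q^{d+ℓ}λ/z) converge absolutely. Then L_μ^{[λ]}(ζ ↦ ζ·g(ζ))(z) = z^n · L_μ^{[λ]}(g)(q^d z), i.e. (Σ_{ℓ∈dℤ} q^ℓλ·g(q^ℓλ)/Θ_{q^d}(q^{d+ℓ}λ/z))^n = z^n · (Σ_{ℓ∈dℤ} g(q^ℓλ)/Θ_{q^d}(q^{ℓ}λ/z))^n. -/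
/-- The functional equation `Θ_Q(Q z) = z Θ_Q(z)`. -/
theorem theta_mul_left {Q z : ℂ} (hQ : Q ≠ 0) (hz : z ≠ 0) :
    theta Q (Q * z) = z * theta Q z := by
  unfold theta
  rw [← tsum_mul_left, ← (Equiv.addRight (1 : ℤ)).tsum_eq]
  refine tsum_congr fun k => ?_
  have hexp : -((k + 1) * (k + 1 + 1)) / 2 + (k + 1) = -(k * (k + 1)) / 2 := by
    have h : -(k * (k + 1)) = -((k + 1) * (k + 1 + 1)) + (k + 1) * 2 := by ring
    rw [h, Int.add_mul_ediv_right _ _ two_ne_zero]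
  rw [Equiv.coe_addRight, mul_zpow, ← mul_assoc, ← zpow_add₀ hQ, hexp, zpow_add_one₀ hz]
  ring

/-- Lemma 1 (second part): `L_μ^{[λ]}(ζ g(ζ))(z) = z^n (σ_q^d L_μ^{[λ]}(g))(z)`. -/
theorem qLaplace_shift (q : ℂ) (hq : 1 < ‖q‖) (n d : ℕ) (hn : 0 < n) (hd : 0 < d)
    (hnd : Nat.Coprime n d) (lam : ℂ) (hlam : lam ≠ 0) (g : ℂ → ℂ) (z : ℂ) (hz : z ≠ 0)
    (hzS : ∀ k : ℤ, z ≠ -lam * q ^ (d * k))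
    (hs1 : Summable fun k : ℤ =>
      ‖g (q ^ (d * k) * lam) / theta (q ^ d) (q ^ ((d : ℤ) + d * k) * lam / z)‖)
    (hs2 : Summable fun k : ℤ =>
      ‖q ^ (d * k) * lam * g (q ^ (d * k) * lam) /
        theta (q ^ d) (q ^ ((d : ℤ) + d * k) * lam / z)‖) :
    (∑' k : ℤ, q ^ (d * k) * lam * g (q ^ (d * k) * lam) /
        theta (q ^ d) (q ^ ((d : ℤ) + d * k) * lam / z)) ^ n
      = z ^ n * (∑' k : ℤ, g (q ^ (d * k) * lam) /
          theta (q ^ d) (q ^ (d * k) * lam / z)) ^ n := by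
  have hq0 : q ≠ 0 := by
    rintro rfl
    norm_num at hq
  rw [← mul_pow, ← tsum_mul_left]
  congr 1
  refine tsum_congr fun k => ?_
  have hx : q ^ (d * k) * lam ≠ 0 := mul_ne_zero (zpow_ne_zero _ hq0) hlam
  have harg : q ^ ((d : ℤ) + d * k) * lam / z = q ^ d * (q ^ (d * k) * lam / z) := by
    rw [zpow_add₀ hq0, zpow_natCast]
    ring
  rw [harg, theta_mul_left (pow_ne_zero d hq0) (div_ne_zero hx hz), div_mul_eq_mul_div,
    div_div_eq_mul_div, mul_assoc (q ^ (d * k) * lam), mul_div_mul_left _ _ hx]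
  ring
end

section
/- Let n, d be positive coprime integers and μ := n/d. Let f(z) = Σ_{ℓ≥0} a_ℓ z^{ℓn} be a power series with positive radius of convergence. Define the q-Borel transform of order μ by B̂_μ(f)(ζ) := Σ_{ℓ≥0} a_ℓ^{1/n} q^{−ℓ(ℓ−1)d/2} ζ^ℓ, where w^{1/n} := exp(n^{−1}·Log w) (principal logarithm) for w ≠ 0 and 0^{1/n} := 0. Then this series has infinite radius of convergence (so B̂_μ(f) is entire), and there exist constants L, M > 0 such that |B̂_μ(f)(ζ)| ≤ L·Θ_{|q|^d}(M|ζ|) for all ζ ∈ ℂ* (|q|^d-exponential growth of order 1 at infinity). -/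
/-- The real theta function `Θ_Q(x) = Σ_{ℓ ∈ ℤ} Q^(-ℓ(ℓ+1)/2) x^ℓ` (for real `Q > 1`, `x > 0`). -/
noncomputable def thetaR (Q x : ℝ) : ℝ := ∑' ℓ : ℤ, Q ^ (-(ℓ * (ℓ + 1)) / 2) * x ^ ℓ

/-- The principal `n`-th root: `w^{1/n} = exp(Log w / n)` for `w ≠ 0`, and `0^{1/n} = 0`. -/
noncomputable def croot (n : ℕ) (w : ℂ) : ℂ :=
  if w = 0 then 0 else Complex.exp (Complex.log w / n)

theorem thetaR_term_succ {Q x : ℝ} (hQ : Q ≠ 0) (hx : x ≠ 0) (ℓ : ℤ) :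
    Q ^ (-((ℓ + 1) * (ℓ + 1 + 1)) / 2) * x ^ (ℓ + 1) =
      (Q ^ (-(ℓ * (ℓ + 1)) / 2) * x ^ ℓ) * (x * Q ^ (-(ℓ + 1))) := by
  have h : -((ℓ + 1) * (ℓ + 1 + 1)) / 2 = -(ℓ * (ℓ + 1)) / 2 + -(ℓ + 1) := by
    rw [← Int.add_mul_ediv_right _ _ (by norm_num : (2 : ℤ) ≠ 0)]
    congr 1
    ring
  rw [h, zpow_add₀ hQ, zpow_add_one₀ hx]
  ring

theorem summable_thetaR_nat {Q x : ℝ} (hQ : 1 < Q) (hx : 0 < x) :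
    Summable fun ℓ : ℕ => Q ^ (-((ℓ : ℤ) * (ℓ + 1)) / 2) * x ^ (ℓ : ℤ) := by
  have hQ0 : 0 < Q := by linarith
  have hpos : ∀ ℓ : ℕ, 0 < Q ^ (-((ℓ : ℤ) * (ℓ + 1)) / 2) * x ^ (ℓ : ℤ) := fun ℓ => by positivity
  refine summable_of_ratio_test_tendsto_lt_one zero_lt_one
    (Filter.Eventually.of_forall fun ℓ => (hpos ℓ).ne') ?_
  have hlim : Filter.Tendsto (fun ℓ : ℕ => x * (Q⁻¹) ^ (ℓ + 1)) Filter.atTop (nhds 0) := by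
    have h := (tendsto_pow_atTop_nhds_zero_of_lt_one (inv_nonneg.2 hQ0.le)
      (inv_lt_one_of_one_lt₀ hQ)).comp (Filter.tendsto_add_atTop_nat 1)
    simpa using h.const_mul x
  refine hlim.congr fun ℓ => ?_
  rw [Real.norm_of_nonneg (hpos _).le, Real.norm_of_nonneg (hpos _).le]
  push_cast
  rw [thetaR_term_succ hQ0.ne' hx.ne', mul_div_cancel_left₀ _ (hpos ℓ).ne', zpow_neg, inv_pow]
  norm_cast

theorem summable_thetaR {Q x : ℝ} (hQ : 1 < Q) (hx : 0 < x) :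
    Summable fun ℓ : ℤ => Q ^ (-(ℓ * (ℓ + 1)) / 2) * x ^ ℓ := by
  refine Summable.of_nat_of_neg_add_one (summable_thetaR_nat hQ hx) ?_
  refine ((summable_thetaR_nat hQ (inv_pos.2 hx)).mul_right x⁻¹).congr fun ℓ => ?_
  rw [mul_assoc, ← zpow_add_one₀ (inv_pos.2 hx).ne', inv_zpow']
  congr 3
  ring

theorem norm_croot_pow {n : ℕ} (hn : 0 < n) (w : ℂ) : ‖croot n w‖ ^ n = ‖w‖ := by
  rw [← norm_pow, croot]
  split_ifs with h
  · simp [h, hn.ne']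
  · rw [← Complex.exp_nat_mul, mul_div_cancel₀ _ (Nat.cast_ne_zero.2 hn.ne'), Complex.exp_log h]

theorem exists_norm_croot_le {n : ℕ} (hn : 0 < n) {a : ℕ → ℂ} {r : ℝ} (hr : 0 < r)
    (hs : Summable fun ℓ : ℕ => ‖a ℓ‖ * r ^ (ℓ * n)) :
    ∃ C : ℝ, 0 < C ∧ ∀ ℓ, ‖croot n (a ℓ)‖ ≤ C * r⁻¹ ^ ℓ := by
  set S := ∑' ℓ : ℕ, ‖a ℓ‖ * r ^ (ℓ * n)
  have hC : 1 ≤ max 1 S := le_max_left _ _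
  refine ⟨max 1 S, by positivity, fun ℓ => ?_⟩
  have hle : ‖croot n (a ℓ)‖ * r ^ ℓ ≤ max 1 S := by
    refine le_of_pow_le_pow_left₀ hn.ne' (by positivity) ?_
    rw [mul_pow, norm_croot_pow hn, ← pow_mul]
    calc ‖a ℓ‖ * r ^ (ℓ * n) ≤ S := hs.le_tsum ℓ fun _ _ => by positivity
      _ ≤ max 1 S := le_max_right _ _
      _ ≤ max 1 S ^ n := le_self_pow₀ hC hn.ne'
  rw [inv_pow, ← div_eq_mul_inv]
  exact (le_div_iff₀ (by positivity)).2 hle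

theorem zpow_qBorel_exponent {Q : ℝ} (hQ : Q ≠ 0) (d : ℕ) (ℓ : ℤ) :
    Q ^ (-(ℓ * (ℓ - 1) * d) / 2) = (Q ^ d) ^ (-(ℓ * (ℓ + 1)) / 2) * (Q ^ d) ^ ℓ := by
  obtain ⟨k, hk⟩ := Int.even_mul_pred_self ℓ
  have h₁ : -(ℓ * (ℓ - 1) * d) / 2 = d * -k := by
    rw [hk]
    exact Int.ediv_eq_of_eq_mul_left two_ne_zero (by ring)
  have h₂ : -(ℓ * (ℓ + 1)) / 2 = -k - ℓ :=
    Int.ediv_eq_of_eq_mul_left two_ne_zero (by linear_combination -hk)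
  rw [h₁, h₂, ← zpow_add₀ (pow_ne_zero d hQ), sub_add_cancel, zpow_mul, zpow_natCast]

/-- The q-Borel transform of order `μ = n/d` of a convergent power series
`f(z) = Σ a_ℓ z^{ℓn}` is an entire function with `|q|^d`-exponential growth of order 1
at infinity. -/
theorem qBorel_entire_growth (q : ℂ) (hq : 1 < ‖q‖) (n d : ℕ) (hn : 0 < n) (hd : 0 < d)
    (hnd : Nat.Coprime n d) (a : ℕ → ℂ)
    (hconv : ∃ r : ℝ, 0 < r ∧ Summable fun ℓ : ℕ => ‖a ℓ‖ * r ^ (ℓ * n)) :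
    (∀ ζ : ℂ, Summable fun ℓ : ℕ =>
      ‖croot n (a ℓ) * q ^ (-(ℓ * (ℓ - 1) * d : ℤ) / 2) * ζ ^ ℓ‖) ∧
    ∃ L M : ℝ, 0 < L ∧ 0 < M ∧ ∀ ζ : ℂ, ζ ≠ 0 →
      ‖∑' ℓ : ℕ, croot n (a ℓ) * q ^ (-(ℓ * (ℓ - 1) * d : ℤ) / 2) * ζ ^ ℓ‖
        ≤ L * thetaR (‖q‖ ^ d) (M * ‖ζ‖) := by
  obtain ⟨r, hr, hs⟩ := hconv
  obtain ⟨C, hC, hle⟩ := exists_norm_croot_le hn hr hs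
  have hq0 : 0 < ‖q‖ := by linarith
  have hQ : 1 < ‖q‖ ^ d := one_lt_pow₀ hq hd.ne'
  have hM : 0 < ‖q‖ ^ d * r⁻¹ := by positivity
  have hterm : ∀ (ζ : ℂ) (ℓ : ℕ),
      ‖croot n (a ℓ) * q ^ (-(ℓ * (ℓ - 1) * d : ℤ) / 2) * ζ ^ ℓ‖ ≤
        C * ((‖q‖ ^ d) ^ (-((ℓ : ℤ) * (ℓ + 1)) / 2) * (‖q‖ ^ d * r⁻¹ * ‖ζ‖) ^ (ℓ : ℤ)) := by
    intro ζ ℓ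
    rw [norm_mul, norm_mul, norm_zpow, norm_pow, zpow_qBorel_exponent hq0.ne']
    calc _ ≤ C * r⁻¹ ^ ℓ * ((‖q‖ ^ d) ^ (-((ℓ : ℤ) * (ℓ + 1)) / 2) * (‖q‖ ^ d) ^ (ℓ : ℤ)) *
          ‖ζ‖ ^ ℓ := by gcongr; exact hle ℓ
      _ = _ := by simp only [zpow_natCast, mul_pow]; ring
  have hsum : ∀ ζ : ℂ, ζ ≠ 0 → Summable fun ℓ : ℕ =>
      ‖croot n (a ℓ) * q ^ (-(ℓ * (ℓ - 1) * d : ℤ) / 2) * ζ ^ ℓ‖ := fun ζ hζ =>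
    Summable.of_nonneg_of_le (fun _ => norm_nonneg _) (hterm ζ)
      ((summable_thetaR_nat hQ (mul_pos hM (norm_pos_iff.2 hζ))).mul_left C)
  refine ⟨fun ζ => ?_, C, ‖q‖ ^ d * r⁻¹, hC, hM, fun ζ hζ => ?_⟩
  · rcases eq_or_ne ζ 0 with rfl | hζ
    · refine summable_of_ne_finset_zero (s := {0}) fun ℓ hℓ => ?_
      simp [zero_pow (Finset.notMem_singleton.1 hℓ)]
    · exact hsum ζ hζ
  · have hx := mul_pos hM (norm_pos_iff.2 hζ)
    refine (norm_tsum_le_tsum_norm (hsum ζ hζ)).trans ?_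
    refine ((hsum ζ hζ).tsum_le_tsum (hterm ζ)
      ((summable_thetaR_nat hQ hx).mul_left C)).trans ?_
    rw [tsum_mul_left, thetaR]
    refine mul_le_mul_of_nonneg_left ?_ hC.le
    exact tsum_comp_le_tsum_of_inj (summable_thetaR hQ hx) (fun _ => by positivity)
      (Nat.cast_injective (R := ℤ))
end

section
/- Let n, d be positive coprime integers, μ := n/d, λ ∈ ℂ*, a ∈ ℂ, and ℓ ∈ ℕ. Then for every z ∈ ℂ* ∖ (−λq^{dℤ}), L_μ^{[λ]} ∘ B̂_μ(a z^{ℓn}) = a z^{ℓn}; explicitly, (a^{1/n} q^{−ℓ(ℓ−1)d/2} Σ_{k∈dℤ} (q^k λ)^ℓ / Θ_{q^d}(q^{d+k}λ/z))^n = a·z^{ℓn}, the bilateral series converging absolutely. Here w^{1/n} := exp(n^{−1}·Log w) for w ≠ 0 and 0^{1/n} := 0. -/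
section

open Filter Topology

/-- The `ℓ`-th coefficient `Q^(-ℓ(ℓ+1)/2)` of the theta function. -/
noncomputable def thetaCoeff (Q : ℂ) (ℓ : ℤ) : ℂ := Q ^ (-(ℓ * (ℓ + 1)) / 2)

theorem thetaCoeff_zero (Q : ℂ) : thetaCoeff Q 0 = 1 := by
  simp [thetaCoeff]

theorem thetaCoeff_ne_zero {Q : ℂ} (hQ : Q ≠ 0) (ℓ : ℤ) : thetaCoeff Q ℓ ≠ 0 :=
  zpow_ne_zero _ hQ

theorem thetaCoeff_add {Q : ℂ} (hQ : Q ≠ 0) (m k : ℤ) :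
    thetaCoeff Q (m + k) = thetaCoeff Q m * thetaCoeff Q k * Q ^ (-(m * k)) := by
  have key : -((m + k) * (m + k + 1)) / 2
      = -(m * (m + 1)) / 2 + -(k * (k + 1)) / 2 + -(m * k) := by
    obtain ⟨a, ha⟩ := (Int.even_mul_succ_self m).two_dvd
    obtain ⟨b, hb⟩ := (Int.even_mul_succ_self k).two_dvd
    have : (m + k) * (m + k + 1) = 2 * (a + b + m * k) := by linear_combination ha + hb
    rw [this, ha, hb]
    omega
  simp only [thetaCoeff]
  rw [key, zpow_add₀ hQ, zpow_add₀ hQ]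

theorem thetaCoeff_one {Q : ℂ} : thetaCoeff Q 1 = Q⁻¹ := by
  simp [thetaCoeff]

theorem thetaCoeff_neg_one {Q : ℂ} : thetaCoeff Q (-1) = 1 := by
  simp [thetaCoeff]

theorem thetaCoeff_neg {Q : ℂ} (hQ : Q ≠ 0) (m : ℤ) :
    thetaCoeff Q (-m) = thetaCoeff Q m * Q ^ m := by
  have h : thetaCoeff Q (-m) = thetaCoeff Q (m - 1) := by
    simp only [thetaCoeff]; congr 2; ring
  rw [h, sub_eq_add_neg, thetaCoeff_add hQ, thetaCoeff_neg_one]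
  simp

theorem tendsto_inv_zpow_natCast {Q : ℂ} (hQ : 1 < ‖Q‖) :
    Tendsto (fun n : ℕ => ‖Q⁻¹ ^ n‖) atTop (𝓝 0) := by
  have h : ‖Q⁻¹‖ < 1 := by rw [norm_inv]; exact inv_lt_one_of_one_lt₀ hQ
  simpa using (tendsto_pow_atTop_nhds_zero_of_norm_lt_one h).norm

theorem summable_thetaCoeff_nat {Q : ℂ} (hQ : 1 < ‖Q‖) {z : ℂ} (hz : z ≠ 0) :
    Summable fun n : ℕ => ‖thetaCoeff Q n * z ^ n‖ := by
  have hQ0 : Q ≠ 0 := norm_pos_iff.1 (zero_lt_one.trans hQ)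
  have hne (n : ℕ) : thetaCoeff Q n * z ^ n ≠ 0 :=
    mul_ne_zero (thetaCoeff_ne_zero hQ0 _) (pow_ne_zero _ hz)
  refine summable_of_ratio_test_tendsto_lt_one zero_lt_one
    (Eventually.of_forall fun n => norm_ne_zero_iff.2 (hne n)) ?_
  have h := (tendsto_inv_zpow_natCast hQ).mul_const ‖Q⁻¹ * z‖
  rw [zero_mul] at h
  refine h.congr fun n => ?_
  rw [norm_norm, norm_norm, ← norm_div, ← norm_mul]
  congr 1
  rw [eq_div_iff (hne n)]
  push_cast
  rw [thetaCoeff_add hQ0, thetaCoeff_one, mul_one, zpow_neg, zpow_natCast, inv_pow]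
  ring

/-- The theta series converges absolutely on `ℂ*`. -/
theorem summable_norm_thetaCoeff {Q : ℂ} (hQ : 1 < ‖Q‖) {z : ℂ} (hz : z ≠ 0) :
    Summable fun ℓ : ℤ => ‖thetaCoeff Q ℓ * z ^ ℓ‖ := by
  have hQ0 : Q ≠ 0 := norm_pos_iff.1 (zero_lt_one.trans hQ)
  refine Summable.of_nat_of_neg ?_ ?_
  · simpa using summable_thetaCoeff_nat hQ hz
  · refine (summable_thetaCoeff_nat hQ (z := Q / z) (div_ne_zero hQ0 hz)).congr fun n => ?_
    rw [thetaCoeff_neg hQ0, zpow_neg, zpow_natCast, zpow_natCast, div_pow]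
    congr 1
    ring

theorem theta_eq_tsum (Q z : ℂ) : theta Q z = ∑' ℓ : ℤ, thetaCoeff Q ℓ * z ^ ℓ := rfl

theorem theta_zpow_mul {Q : ℂ} (hQ : Q ≠ 0) {z : ℂ} (hz : z ≠ 0) (k : ℤ) :
    theta Q (Q ^ k * z) * thetaCoeff Q (-k) = z ^ k * theta Q z := by
  rw [theta_eq_tsum, theta_eq_tsum, ← (Equiv.addRight k).tsum_eq, ← tsum_mul_left,
    ← tsum_mul_right]
  refine tsum_congr fun m => ?_
  have h : thetaCoeff Q m = thetaCoeff Q (m + k) * thetaCoeff Q (-k) * Q ^ ((m + k) * k) := by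
    rw [show m = m + k + -k by ring, thetaCoeff_add hQ]
    simp
  rw [Equiv.coe_addRight, h, mul_zpow, ← zpow_mul, mul_comm k, zpow_add₀ hz]
  ring

theorem theta_inv {Q : ℂ} (hQ : Q ≠ 0) {z : ℂ} (hz : z ≠ 0) :
    theta Q z⁻¹ = z * theta Q z := by
  have h := theta_zpow_mul hQ hz 1
  rw [thetaCoeff_neg_one, mul_one, zpow_one, zpow_one] at h
  rw [← h, theta_eq_tsum, theta_eq_tsum, ← (Equiv.neg ℤ).tsum_eq]
  refine tsum_congr fun m => ?_
  rw [Equiv.neg_apply, thetaCoeff_neg hQ, mul_zpow, inv_zpow', neg_neg]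
  ring

/-- The finite product `∏_{i<N} (1 - Q^(-i-1))`. -/
noncomputable def qFactorial (Q : ℂ) (N : ℕ) : ℂ := ∏ i ∈ Finset.range N, (1 - Q⁻¹ ^ (i + 1))

/-- The reciprocal of `qFactorial`, extended by `0` to negative integers. -/
noncomputable def qFactorialInv (Q : ℂ) (m : ℤ) : ℂ :=
  if m < 0 then 0 else (qFactorial Q m.toNat)⁻¹

theorem one_sub_inv_pow_ne_zero {Q : ℂ} (hQ : 1 < ‖Q‖) (i : ℕ) : 1 - Q⁻¹ ^ (i + 1) ≠ 0 := by
  intro h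
  have h1 : ‖Q⁻¹ ^ (i + 1)‖ = 1 := by rw [← sub_eq_zero.1 h, norm_one]
  have h2 : ‖Q⁻¹ ^ (i + 1)‖ < 1 := by
    rw [norm_pow, norm_inv]
    exact pow_lt_one₀ (by positivity) (inv_lt_one_of_one_lt₀ hQ) (by omega)
  exact h2.ne h1

theorem qFactorial_ne_zero {Q : ℂ} (hQ : 1 < ‖Q‖) (N : ℕ) : qFactorial Q N ≠ 0 :=
  Finset.prod_ne_zero_iff.2 fun i _ => one_sub_inv_pow_ne_zero hQ i

theorem qFactorialInv_natCast (Q : ℂ) (N : ℕ) :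
    qFactorialInv Q N = (qFactorial Q N)⁻¹ := by
  simp [qFactorialInv]

theorem qFactorialInv_sub_one {Q : ℂ} (hQ : 1 < ‖Q‖) (m : ℤ) :
    qFactorialInv Q (m - 1) = (1 - Q ^ (-m)) * qFactorialInv Q m := by
  rcases lt_trichotomy m 0 with hm | rfl | hm
  · simp [qFactorialInv, hm, show m - 1 < 0 by omega]
  · simp [qFactorialInv]
  · obtain ⟨k, rfl⟩ : ∃ k : ℕ, m = ((k + 1 : ℕ) : ℤ) := ⟨m.toNat - 1, by omega⟩
    have hk : ((k + 1 : ℕ) : ℤ) - 1 = (k : ℕ) := by push_cast; ring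
    rw [hk, qFactorialInv_natCast, qFactorialInv_natCast, qFactorial, qFactorial,
      Finset.prod_range_succ, mul_inv, zpow_neg, zpow_natCast, ← inv_pow]
    rw [mul_left_comm, mul_inv_cancel₀ (one_sub_inv_pow_ne_zero hQ k), mul_one]

/-- The Laurent coefficients of the `N`-th partial triple product. -/
noncomputable def tripleCoeff (Q : ℂ) (N : ℕ) (j : ℤ) : ℂ :=
  qFactorial Q (2 * N) * qFactorialInv Q (N + j) * qFactorialInv Q (N - j) * thetaCoeff Q j

/-- The `i`-th factor of the triple product. -/
noncomputable def tripleFactor (Q z : ℂ) (i : ℕ) : ℂ :=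
  (1 + z * Q⁻¹ ^ (i + 1)) * (1 + Q⁻¹ ^ i / z)

theorem tripleCoeff_succ {Q : ℂ} (hQ : 1 < ‖Q‖) (N : ℕ) (j : ℤ) :
    tripleCoeff Q (N + 1) j = (1 + Q⁻¹ ^ (2 * N + 1)) * tripleCoeff Q N j
      + Q⁻¹ ^ (N + 1) * tripleCoeff Q N (j - 1) + Q⁻¹ ^ N * tripleCoeff Q N (j + 1) := by
  have hQ0 : Q ≠ 0 := norm_pos_iff.1 (zero_lt_one.trans hQ)
  have e1 : qFactorialInv Q (N + j)
      = (1 - Q ^ (-((N : ℤ) + 1 + j))) * qFactorialInv Q (N + 1 + j) := by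
    rw [← qFactorialInv_sub_one hQ]; congr 1; ring
  have e2 : qFactorialInv Q (N - j)
      = (1 - Q ^ (-((N : ℤ) + 1 - j))) * qFactorialInv Q (N + 1 - j) := by
    rw [← qFactorialInv_sub_one hQ]; congr 1; ring
  have e3 : qFactorialInv Q (N + (j - 1)) = (1 - Q ^ (-((N : ℤ) + j))) * qFactorialInv Q (N + j) := by
    rw [← qFactorialInv_sub_one hQ]; congr 1; ring
  have e4 : qFactorialInv Q (N - (j + 1)) = (1 - Q ^ (-((N : ℤ) - j))) * qFactorialInv Q (N - j) := by
    rw [← qFactorialInv_sub_one hQ]; congr 1; ring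
  have e5 : (N : ℤ) - (j - 1) = N + 1 - j := by ring
  have e6 : (N : ℤ) + (j + 1) = N + 1 + j := by ring
  have e7 : thetaCoeff Q (j - 1) = thetaCoeff Q j * Q ^ j := by
    rw [sub_eq_add_neg, thetaCoeff_add hQ0, thetaCoeff_neg_one]; simp
  have e8 : thetaCoeff Q (j + 1) = thetaCoeff Q j * Q⁻¹ * (Q ^ j)⁻¹ := by
    rw [thetaCoeff_add hQ0, thetaCoeff_one]; simp
  have e9 : qFactorial Q (2 * (N + 1))
      = qFactorial Q (2 * N) * (1 - Q⁻¹ ^ (2 * N + 1)) * (1 - Q⁻¹ ^ (2 * N + 2)) := by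
    rw [show 2 * (N + 1) = 2 * N + 1 + 1 by ring, qFactorial, Finset.prod_range_succ,
      Finset.prod_range_succ, qFactorial]
  simp only [tripleCoeff]
  rw [e9, e5, e6, e3, e4, e1, e2, e7, e8]
  push_cast
  have hj : Q ^ j ≠ 0 := zpow_ne_zero _ hQ0
  have hN : Q ^ N ≠ 0 := pow_ne_zero _ hQ0
  simp only [neg_add, zpow_add₀ hQ0, zpow_neg, zpow_one, zpow_natCast,
    inv_pow, pow_add, pow_mul, pow_one, pow_two, sub_eq_add_neg, neg_neg, mul_pow]
  generalize Q ^ j = B at *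
  generalize Q ^ N = A at *
  field_simp
  ring

theorem tripleFactor_eq {Q z : ℂ} (hz : z ≠ 0) (i : ℕ) :
    tripleFactor Q z i = 1 + (Q⁻¹ ^ (2 * i + 1) + Q⁻¹ ^ (i + 1) * z + Q⁻¹ ^ i * z⁻¹) := by
  rw [tripleFactor]
  field_simp
  ring

/-- The finite form of Jacobi's triple product identity. -/
theorem hasSum_tripleCoeff {Q : ℂ} (hQ : 1 < ‖Q‖) {z : ℂ} (hz : z ≠ 0) (N : ℕ) :
    HasSum (fun j : ℤ => tripleCoeff Q N j * z ^ j)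
      (∏ i ∈ Finset.range N, tripleFactor Q z i) := by
  induction N with
  | zero =>
    have h : ∀ j : ℤ, j ≠ 0 → tripleCoeff Q 0 j * z ^ j = 0 := by
      intro j hj
      rcases lt_or_gt_of_ne hj with h | h
      · simp [tripleCoeff, qFactorialInv, h]
      · simp [tripleCoeff, qFactorialInv, h]
    convert hasSum_single (0 : ℤ) h
    simp [tripleCoeff, qFactorialInv, qFactorial, thetaCoeff_zero]
  | succ N ih =>
    have h1 : HasSum (fun j : ℤ => tripleCoeff Q N (j - 1) * z ^ j)
        (z * ∏ i ∈ Finset.range N, tripleFactor Q z i) := by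
      refine HasSum.congr_fun (((Equiv.subRight (1 : ℤ)).hasSum_iff.2 ih).mul_left z) fun j => ?_
      rw [Function.comp_apply, Equiv.subRight_apply, zpow_sub_one₀ hz]
      field_simp
    have h2 : HasSum (fun j : ℤ => tripleCoeff Q N (j + 1) * z ^ j)
        (z⁻¹ * ∏ i ∈ Finset.range N, tripleFactor Q z i) := by
      refine HasSum.congr_fun (((Equiv.addRight (1 : ℤ)).hasSum_iff.2 ih).mul_left z⁻¹) fun j => ?_
      rw [Function.comp_apply, Equiv.coe_addRight, zpow_add_one₀ hz]
      field_simp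
    have hprod : ∏ i ∈ Finset.range (N + 1), tripleFactor Q z i
        = (1 + Q⁻¹ ^ (2 * N + 1)) * ∏ i ∈ Finset.range N, tripleFactor Q z i
          + Q⁻¹ ^ (N + 1) * (z * ∏ i ∈ Finset.range N, tripleFactor Q z i)
          + Q⁻¹ ^ N * (z⁻¹ * ∏ i ∈ Finset.range N, tripleFactor Q z i) := by
      rw [Finset.prod_range_succ, tripleFactor_eq hz]
      ring
    rw [hprod]
    refine HasSum.congr_fun (((ih.mul_left (1 + Q⁻¹ ^ (2 * N + 1))).add
      (h1.mul_left (Q⁻¹ ^ (N + 1)))).add (h2.mul_left (Q⁻¹ ^ N))) fun j => ?_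
    rw [tripleCoeff_succ hQ]
    ring

theorem summable_norm_inv_pow {Q : ℂ} (hQ : 1 < ‖Q‖) : Summable fun i : ℕ => ‖Q⁻¹ ^ i‖ := by
  simp only [norm_pow]
  exact summable_geometric_of_lt_one (norm_nonneg _)
    (by rw [norm_inv]; exact inv_lt_one_of_one_lt₀ hQ)

/-- `qFactorial` has a nonzero limit. -/
theorem exists_tendsto_qFactorial {Q : ℂ} (hQ : 1 < ‖Q‖) :
    ∃ E : ℂ, E ≠ 0 ∧ Tendsto (qFactorial Q) atTop (𝓝 E) := by
  have hs : Summable fun i : ℕ => ‖-Q⁻¹ ^ (i + 1)‖ := by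
    simpa only [norm_neg] using (summable_nat_add_iff 1).2 (summable_norm_inv_pow hQ)
  refine ⟨∏' i : ℕ, (1 + -Q⁻¹ ^ (i + 1)), tprod_one_add_ne_zero_of_summable (fun i => ?_) hs, ?_⟩
  · rw [← sub_eq_add_neg]
    exact one_sub_inv_pow_ne_zero hQ i
  · simpa only [← sub_eq_add_neg, qFactorial] using!
      (multipliable_one_add_of_summable hs).hasProd.tendsto_prod_nat

theorem exists_tendsto_tripleFactor {Q : ℂ} (hQ : 1 < ‖Q‖) {z : ℂ} (hz : z ≠ 0)
    (hzS : ∀ k : ℤ, z ≠ -Q ^ k) :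
    ∃ P : ℂ, P ≠ 0 ∧
      Tendsto (fun N => ∏ i ∈ Finset.range N, tripleFactor Q z i) atTop (𝓝 P) := by
  have hQ0 : Q ≠ 0 := norm_pos_iff.1 (zero_lt_one.trans hQ)
  set u : ℕ → ℂ := fun i => Q⁻¹ ^ (2 * i + 1) + Q⁻¹ ^ (i + 1) * z + Q⁻¹ ^ i * z⁻¹ with hu
  have hs0 := summable_norm_inv_pow hQ
  have hs : Summable fun i : ℕ => ‖u i‖ := by
    refine Summable.norm (Summable.add (Summable.add ?_ ?_) ?_)
    · exact hs0.of_norm.comp_injective (i := fun i : ℕ => 2 * i + 1) fun a b h => by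
        simpa using h
    · exact ((summable_nat_add_iff 1).2 hs0.of_norm).mul_right z
    · exact hs0.of_norm.mul_right z⁻¹
  have hf (i : ℕ) : tripleFactor Q z i = 1 + u i := tripleFactor_eq hz i
  refine ⟨∏' i : ℕ, (1 + u i), tprod_one_add_ne_zero_of_summable (fun i => ?_) hs, ?_⟩
  · rw [← hf]
    refine mul_ne_zero (fun h => hzS (i + 1) ?_) (fun h => hzS (-i) ?_)
    · have hQi : Q ^ (i + 1) ≠ 0 := pow_ne_zero _ hQ0
      rw [inv_pow] at h
      field_simp at h
      rw [show ((i : ℤ) + 1) = ((i + 1 : ℕ) : ℤ) by push_cast; rfl, zpow_natCast]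
      linear_combination h
    · rw [zpow_neg, zpow_natCast, ← inv_pow]
      field_simp at h
      linear_combination h
  · simp only [hf]
    exact (multipliable_one_add_of_summable hs).hasProd.tendsto_prod_nat

theorem exists_norm_le_of_tendsto {u : ℕ → ℂ} {a : ℂ} (h : Tendsto u atTop (𝓝 a)) :
    ∃ C : ℝ, ∀ n, ‖u n‖ ≤ C := by
  obtain ⟨C, hC⟩ := h.norm.bddAbove_range
  exact ⟨C, fun n => hC ⟨n, rfl⟩⟩

/-- The zeros of `theta Q` all lie in `-Q^ℤ`. -/
theorem theta_ne_zero {Q : ℂ} (hQ : 1 < ‖Q‖) {z : ℂ} (hz : z ≠ 0)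
    (hzS : ∀ k : ℤ, z ≠ -Q ^ k) : theta Q z ≠ 0 := by
  obtain ⟨E, hE0, hE⟩ := exists_tendsto_qFactorial hQ
  obtain ⟨P, hP0, hP⟩ := exists_tendsto_tripleFactor hQ hz hzS
  have hEi : Tendsto (fun N : ℕ => qFactorialInv Q N) atTop (𝓝 E⁻¹) := by
    simpa only [qFactorialInv_natCast] using hE.inv₀ hE0
  obtain ⟨C, hC⟩ := exists_norm_le_of_tendsto hE
  obtain ⟨D, hD⟩ := exists_norm_le_of_tendsto hEi
  have hC0 : 0 ≤ C := (norm_nonneg _).trans (hC 0)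
  have hD0 : 0 ≤ D := (norm_nonneg _).trans (hD 0)
  have hD' (m : ℤ) : ‖qFactorialInv Q m‖ ≤ D := by
    rcases lt_or_ge m 0 with h | h
    · simpa [qFactorialInv, h] using hD0
    · lift m to ℕ using h
      exact hD m
  have hshift (f : ℕ → ℤ) (j : ℤ) (hf : ∀ N : ℕ, (N : ℤ) - j.natAbs ≤ f N) :
      Tendsto (fun N : ℕ => qFactorialInv Q (f N)) atTop (𝓝 E⁻¹) := by
    have hg : Tendsto (fun N => (f N).toNat) atTop atTop := by
      refine tendsto_atTop.2 fun b => ?_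
      filter_upwards [eventually_ge_atTop (b + j.natAbs)] with N hN
      have := hf N
      omega
    refine (hEi.comp hg).congr' ?_
    filter_upwards [eventually_ge_atTop j.natAbs] with N hN
    have := hf N
    rw [Function.comp_apply, Int.toNat_of_nonneg (by omega)]
  have hlim : Tendsto (fun N => ∑' j : ℤ, tripleCoeff Q N j * z ^ j) atTop
      (𝓝 (∑' j : ℤ, E⁻¹ * (thetaCoeff Q j * z ^ j))) := by
    refine tendsto_tsum_of_dominated_convergence
      (bound := fun j => C * D * D * ‖thetaCoeff Q j * z ^ j‖)
      ((summable_norm_thetaCoeff hQ hz).mul_left _) (fun j => ?_)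
      (Eventually.of_forall fun N j => ?_)
    · have h2 : Tendsto (fun N : ℕ => 2 * N) atTop atTop :=
        tendsto_id.const_mul_atTop' two_pos
      have h := (((hE.comp h2).mul (hshift (fun N => N + j) j
        fun N => by omega)).mul (hshift (fun N => N - j) j
        fun N => by omega)).mul_const (thetaCoeff Q j * z ^ j)
      rw [mul_inv_cancel₀ hE0, one_mul] at h
      refine h.congr fun N => ?_
      simp only [tripleCoeff, Function.comp_apply]
      ring
    · rw [tripleCoeff, mul_assoc _ (thetaCoeff Q j), norm_mul, norm_mul, norm_mul]
      gcongr
      · exact hC _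
      · exact hD' _
      · exact hD' _
  simp only [(hasSum_tripleCoeff hQ hz _).tsum_eq] at hlim
  rw [tsum_mul_left, ← theta_eq_tsum] at hlim
  intro h0
  rw [h0, mul_zero] at hlim
  exact hP0 (tendsto_nhds_unique hP hlim)

theorem croot_pow {n : ℕ} (hn : 0 < n) (w : ℂ) : croot n w ^ n = w := by
  rw [croot]
  split_ifs with h
  · rw [h, zero_pow hn.ne']
  · rw [← Complex.exp_nat_mul, mul_div_cancel₀ _ (Nat.cast_ne_zero.2 hn.ne'), Complex.exp_log h]

/-- The terms of the `q`-Laplace transform of `ζ^ℓ` are multiples of those of a theta series. -/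
theorem zpow_mul_pow_div_theta {Q : ℂ} (hQ : Q ≠ 0) {lam z : ℂ} (hlam : lam ≠ 0) (hz : z ≠ 0)
    (ℓ : ℕ) (k : ℤ) :
    (Q ^ k * lam) ^ ℓ / theta Q (Q ^ (k + 1) * (lam / z))
      = lam ^ ℓ / (lam / z * theta Q (lam / z))
        * (thetaCoeff Q k * (Q ^ (ℓ : ℤ) * (lam / z)⁻¹) ^ k) := by
  have hx : lam / z ≠ 0 := div_ne_zero hlam hz
  have h := theta_zpow_mul hQ hx (k + 1)
  have hT : thetaCoeff Q (-(k + 1)) = thetaCoeff Q k := by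
    simp only [thetaCoeff]; congr 2; ring
  rw [hT] at h
  rw [← mul_div_cancel_right₀ (theta Q (Q ^ (k + 1) * (lam / z))) (thetaCoeff_ne_zero hQ k), h,
    mul_pow, mul_zpow, ← zpow_mul, mul_comm (ℓ : ℤ), zpow_mul, zpow_natCast, inv_zpow,
    zpow_add_one₀ hx]
  field_simp

theorem tsum_zpow_mul_pow_div_theta {Q : ℂ} (hQ : Q ≠ 0) {lam z : ℂ} (hlam : lam ≠ 0)
    (hz : z ≠ 0) (hθ : theta Q (lam / z) ≠ 0) (ℓ : ℕ) :
    thetaCoeff Q (-ℓ) * ∑' k : ℤ, (Q ^ k * lam) ^ ℓ / theta Q (Q ^ (k + 1) * (lam / z))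
      = z ^ ℓ := by
  have hx : lam / z ≠ 0 := div_ne_zero hlam hz
  simp only [zpow_mul_pow_div_theta hQ hlam hz]
  rw [tsum_mul_left, ← theta_eq_tsum]
  have h := theta_zpow_mul hQ (inv_ne_zero hx) ℓ
  rw [theta_inv hQ hx] at h
  rw [mul_left_comm, mul_comm (thetaCoeff _ _), h, zpow_natCast, inv_div, div_pow]
  field_simp

end

/-- `L_μ^{[λ]} ∘ B̂_μ (a z^{ℓn}) = a z^{ℓn}` for monomials, `μ = n/d`. -/
theorem qLaplace_qBorel_monomial (q : ℂ) (hq : 1 < ‖q‖) (n d : ℕ) (hn : 0 < n) (hd : 0 < d)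
    (hnd : Nat.Coprime n d) (lam : ℂ) (hlam : lam ≠ 0) (a : ℂ) (ℓ : ℕ)
    (z : ℂ) (hz : z ≠ 0) (hzS : ∀ k : ℤ, z ≠ -lam * q ^ (d * k)) :
    (Summable fun k : ℤ =>
      ‖(q ^ (d * k) * lam) ^ ℓ / theta (q ^ d) (q ^ ((d : ℤ) + d * k) * lam / z)‖) ∧
    (croot n a * q ^ (-(ℓ * (ℓ - 1) * d : ℤ) / 2) *
        ∑' k : ℤ, (q ^ (d * k) * lam) ^ ℓ /
          theta (q ^ d) (q ^ ((d : ℤ) + d * k) * lam / z)) ^ n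
      = a * z ^ (ℓ * n) := by
  have hq0 : q ≠ 0 := norm_pos_iff.1 (zero_lt_one.trans hq)
  have hQ : 1 < ‖q ^ d‖ := by rw [norm_pow]; exact one_lt_pow₀ hq hd.ne'
  have hQ0 : q ^ d ≠ 0 := pow_ne_zero _ hq0
  have hpow (k : ℤ) : q ^ (d * k) = (q ^ d) ^ k := by rw [zpow_mul, zpow_natCast]
  have hterm (k : ℤ) : (q ^ (d * k) * lam) ^ ℓ / theta (q ^ d) (q ^ ((d : ℤ) + d * k) * lam / z)
      = ((q ^ d) ^ k * lam) ^ ℓ / theta (q ^ d) ((q ^ d) ^ (k + 1) * (lam / z)) := by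
    rw [hpow, show (d : ℤ) + d * k = d * (k + 1) by ring, hpow, mul_div_assoc]
  have hθ : theta (q ^ d) (lam / z) ≠ 0 := by
    refine theta_ne_zero hQ (div_ne_zero hlam hz) fun k hk => hzS (-k) ?_
    rw [hpow, zpow_neg]
    have := zpow_ne_zero k hQ0
    field_simp at hk ⊢
    linear_combination hk
  have hcoeff : q ^ (-(ℓ * (ℓ - 1) * d : ℤ) / 2) = thetaCoeff (q ^ d) (-ℓ) := by
    rw [thetaCoeff, ← hpow]
    congr 1
    obtain ⟨b, hb⟩ := (Int.even_mul_pred_self ℓ).two_dvd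
    rw [show -(-(ℓ : ℤ) * (-ℓ + 1)) = 2 * -b by linear_combination -hb,
      show -((ℓ : ℤ) * (ℓ - 1) * d) = 2 * (d * -b) by linear_combination -(d : ℤ) * hb,
      Int.mul_ediv_cancel_left _ two_ne_zero, Int.mul_ediv_cancel_left _ two_ne_zero]
  simp only [hterm]
  refine ⟨?_, ?_⟩
  · simp only [zpow_mul_pow_div_theta hQ0 hlam hz, norm_mul _ (thetaCoeff _ _ * _)]
    exact (summable_norm_thetaCoeff hQ (mul_ne_zero (zpow_ne_zero _ hQ0)
      (inv_ne_zero (div_ne_zero hlam hz)))).mul_left _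
  · rw [hcoeff, mul_assoc, tsum_zpow_mul_pow_div_theta hQ0 hlam hz hθ, mul_pow, croot_pow hn,
      pow_mul]
end

section
/- Let n, d ≥ 1 be integers, a, c ∈ ℂ*, λ ∈ ℂ* with c·λ^n ∉ a·q^{dℤ} (i.e. c·λ^n·q^{dk} ≠ a for all k ∈ ℤ), and let b be a meromorphic function on ℂ*. If y₁ and y₂ are meromorphic functions on ℂ* which both satisfy c·z^n·y(q^d z) = a·y(z) − b(z) and whose poles are all contained in the q^d-spiral −λq^{dℤ} with order at most n, then y₁ = y₂. -/
open Filter Topology Function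

/-- An entire function `E` with `E 0 = 1` and `E v = (1 + v) E (v / Q)`. -/
lemma exists_entire_eq_one_add_mul {Q : ℂ} (hQ : 1 < ‖Q‖) :
    ∃ E : ℂ → ℂ, Differentiable ℂ E ∧ E 0 = 1 ∧ ∀ v, E v = (1 + v) * E (v * Q⁻¹) := by
  have hr : ‖Q⁻¹‖ < 1 := by rw [norm_inv]; exact inv_lt_one_of_one_lt₀ hQ
  have hsum : ∀ v : ℂ, Summable fun k : ℕ => ‖v * Q⁻¹ ^ k‖ := fun v => by
    simp_rw [norm_mul, norm_pow]
    exact (summable_geometric_of_lt_one (norm_nonneg _) hr).mul_left _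
  refine ⟨fun v => ∏' k : ℕ, (1 + v * Q⁻¹ ^ k), ?_, by simp, fun v => ?_⟩
  · intro v
    have h := Summable.hasProdLocallyUniformlyOn_nat_one_add
      (f := fun (k : ℕ) (z : ℂ) => z * Q⁻¹ ^ k) (K := Metric.ball 0 (‖v‖ + 1))
      Metric.isOpen_ball
      (((summable_geometric_of_lt_one (norm_nonneg _) hr)).mul_left (‖v‖ + 1))
      (Eventually.of_forall fun k z hz => by
        rw [norm_mul, norm_pow]
        have : ‖z‖ < ‖v‖ + 1 := by simpa using hz
        gcongr)
      (fun k => by fun_prop)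
    have hd := (h.tendstoLocallyUniformlyOn_finsetRange).differentiableOn
      (Eventually.of_forall fun N => by
        fun_prop) Metric.isOpen_ball
    exact hd.differentiableAt (Metric.isOpen_ball.mem_nhds (by simp))
  · have hm : Multipliable fun k : ℕ => 1 + v * Q⁻¹ ^ (k + 1) :=
      multipliable_one_add_of_summable ((hsum v).comp_injective (add_left_injective 1))
    simp only
    rw [tprod_eq_zero_mul' (f := fun k : ℕ => 1 + v * Q⁻¹ ^ k) hm]
    simp only [pow_zero, mul_one, pow_succ', mul_assoc]

/-- A theta function for `Q`, vanishing at `-1`. -/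
lemma exists_theta {Q : ℂ} (hQ : 1 < ‖Q‖) :
    ∃ θ : ℂ → ℂ, (∀ w, w ≠ 0 → AnalyticAt ℂ θ w) ∧ (∀ w, w ≠ 0 → θ (Q * w) = w * θ w) ∧
      θ (-1) = 0 ∧ ∀ w, w ≠ 0 → ∀ᶠ z in 𝓝[≠] w, θ z ≠ 0 := by
  have hQ0 : Q ≠ 0 := norm_pos_iff.1 (by linarith)
  obtain ⟨E, hE, hE0, hfe⟩ := exists_entire_eq_one_add_mul hQ
  have hEne : ∀ v, ∀ᶠ z in 𝓝[≠] v, E z ≠ 0 := fun v => by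
    refine (hE.analyticAt v).eventually_eq_zero_or_eventually_ne_zero.resolve_left fun h => ?_
    have := AnalyticOnNhd.eqOn_zero_of_preconnected_of_eventuallyEq_zero
      (fun z _ => hE.analyticAt z) isPreconnected_univ (Set.mem_univ v) h (Set.mem_univ 0)
    simp [hE0] at this
  refine ⟨fun w => E (w * Q⁻¹) * E w⁻¹, fun w hw => ?_, fun w hw => ?_, ?_, fun w hw => ?_⟩
  · exact ((hE.analyticAt _).fun_comp (by fun_prop)).mul ((hE.analyticAt _).fun_comp (analyticAt_inv hw))
  · have h1 : Q * w * Q⁻¹ = w := by field_simp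
    have h2 : w⁻¹ * Q⁻¹ = (Q * w)⁻¹ := by rw [mul_inv, mul_comm]
    simp only
    rw [h1, hfe w, hfe w⁻¹, h2]
    field_simp
    ring
  · have : E (-1) = 0 := by rw [hfe]; simp
    simp [this, inv_neg]
  · have t1 : Tendsto (fun z : ℂ => z * Q⁻¹) (𝓝[≠] w) (𝓝[≠] (w * Q⁻¹)) :=
      ContinuousAt.tendsto (by fun_prop) |>.mono_left nhdsWithin_le_nhds |> fun h =>
        tendsto_nhdsWithin_of_tendsto_nhds_of_eventually_within _ h
          (eventually_mem_nhdsWithin.mono fun z hz => by simpa [hQ0] using hz)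
    have t2 : Tendsto (fun z : ℂ => z⁻¹) (𝓝[≠] w) (𝓝[≠] w⁻¹) :=
      (tendsto_inv₀ hw).mono_left nhdsWithin_le_nhds |> fun h =>
        tendsto_nhdsWithin_of_tendsto_nhds_of_eventually_within _ h
          (eventually_mem_nhdsWithin.mono fun z hz => by simpa using hz)
    filter_upwards [t1.eventually (hEne _), t2.eventually (hEne _)] with z h1 h2
    exact mul_ne_zero h1 h2

lemma tendsto_const_mul_nhdsNE {Q : ℂ} (hQ0 : Q ≠ 0) (z : ℂ) :
    Tendsto (fun w : ℂ => Q * w) (𝓝[≠] z) (𝓝[≠] (Q * z)) :=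
  tendsto_nhdsWithin_of_tendsto_nhds_of_eventually_within _
    ((continuous_const_mul Q).continuousAt.tendsto.mono_left nhdsWithin_le_nhds)
    (eventually_mem_nhdsWithin.mono fun w hw => by simpa [hQ0] using hw)

/-- A function analytic at `0` with `G (Q z) = ν G z` vanishes near `0` unless `ν` is a power
of `Q`. -/
lemma AnalyticAt.eventually_eq_zero_of_dilation {Q ν : ℂ} {G : ℂ → ℂ}
    (hG : AnalyticAt ℂ G 0) (hν : ∀ m : ℕ, Q ^ m ≠ ν)
    (hfe : ∀ᶠ z in 𝓝[≠] 0, G (Q * z) = ν * G z) : ∀ᶠ z in 𝓝 0, G z = 0 := by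
  by_contra hne
  obtain ⟨m, g, hg, hg0, hGg⟩ := hG.exists_eventuallyEq_pow_smul_nonzero_iff.2 hne
  have ht : Tendsto (fun w : ℂ => Q * w) (𝓝 0) (𝓝 0) := by
    simpa using (continuous_const_mul Q).tendsto 0
  have h1 : ∀ᶠ z in 𝓝[≠] (0 : ℂ), Q ^ m * g (Q * z) = ν * g z := by
    filter_upwards [hfe, nhdsWithin_le_nhds hGg, nhdsWithin_le_nhds (ht.eventually hGg),
      self_mem_nhdsWithin] with z h1 h2 h3 h4
    have hz : z ≠ 0 := h4
    rw [h2, h3] at h1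
    simp only [sub_zero, smul_eq_mul, mul_pow] at h1
    have : z ^ m ≠ 0 := pow_ne_zero _ hz
    apply mul_left_cancel₀ this
    linear_combination h1
  have c1 : ContinuousAt (fun z => Q ^ m * g (Q * z)) 0 :=
    continuousAt_const.mul (ContinuousAt.comp' (by simpa using hg.continuousAt) (by fun_prop))
  have c2 : ContinuousAt (fun z => ν * g z) 0 := continuousAt_const.mul hg.continuousAt
  have h2 := ((c1.eventuallyEq_nhds_iff_eventuallyEq_nhdsNE c2).1 h1).eq_of_nhds
  simp only [mul_zero] at h2
  exact hν m (mul_right_cancel₀ hg0 h2)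

/-- A holomorphic function on `ℂ ∖ {0}` with `f (Q z) = μ f z` vanishes unless `μ` is an integral
power of `Q`. -/
lemma eq_zero_of_dilation {Q μ : ℂ} (hQ : 1 < ‖Q‖) (hμ0 : μ ≠ 0) (hμ : ∀ m : ℤ, Q ^ m ≠ μ)
    {f : ℂ → ℂ} (hf : ∀ z, z ≠ 0 → AnalyticAt ℂ f z)
    (hfe : ∀ z, z ≠ 0 → f (Q * z) = μ * f z) : ∀ z, z ≠ 0 → f z = 0 := by
  have hQ0 : Q ≠ 0 := norm_pos_iff.1 (by linarith)
  obtain ⟨N, hN⟩ : ∃ N : ℕ, 1 ≤ ‖Q ^ N * μ‖ := by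
    obtain ⟨N, hN⟩ := pow_unbounded_of_one_lt ‖μ‖⁻¹ hQ
    refine ⟨N, ?_⟩
    rw [norm_mul, norm_pow]
    have : 0 < ‖μ‖ := norm_pos_iff.2 hμ0
    exact (inv_le_iff_one_le_mul₀ this).1 hN.le
  set F : ℂ → ℂ := fun z => z ^ N * f z with hF
  have hFfe : ∀ z, z ≠ 0 → F (Q * z) = (Q ^ N * μ) * F z := fun z hz => by
    simp only [hF, hfe z hz, mul_pow]; ring
  have hFan : ∀ z, z ≠ 0 → AnalyticAt ℂ F z := fun z hz =>
    (analyticAt_id.pow N).mul (hf z hz)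
  obtain ⟨C, hC⟩ : ∃ C, ∀ z : ℂ, 1 ≤ ‖z‖ → ‖z‖ ≤ ‖Q‖ → ‖F z‖ ≤ C := by
    have hK : IsCompact (Metric.closedBall (0 : ℂ) ‖Q‖ ∩ {z | 1 ≤ ‖z‖}) :=
      (isCompact_closedBall _ _).inter_right (isClosed_le continuous_const continuous_norm)
    obtain ⟨C, hC⟩ := hK.exists_bound_of_continuousOn (f := F) fun z hz =>
      (hFan z (norm_pos_iff.1 (lt_of_lt_of_le one_pos hz.2))).continuousAt.continuousWithinAt
    exact ⟨C, fun z h1 h2 => hC z ⟨by simpa using h2, h1⟩⟩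
  have hbound : ∀ (j : ℕ) (z : ℂ), 1 ≤ ‖z‖ * ‖Q‖ ^ j → ‖z‖ ≤ ‖Q‖ → ‖F z‖ ≤ C := by
    intro j
    induction j with
    | zero => intro z h1 h2; exact hC z (by simpa using h1) h2
    | succ j ih =>
      intro z h1 h2
      rcases le_or_gt 1 ‖z‖ with h | h
      · exact hC z h h2
      · have hz : z ≠ 0 := by rintro rfl; simp at h1; linarith
        have := ih (Q * z) (by rw [norm_mul]; rw [pow_succ] at h1; linarith)
          (by rw [norm_mul]; nlinarith)
        rw [hFfe z hz, norm_mul] at this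
        nlinarith [norm_nonneg (F z)]
  have hball : Metric.closedBall (0 : ℂ) ‖Q‖ ∈ 𝓝 (0 : ℂ) :=
    Metric.closedBall_mem_nhds _ (by linarith)
  have hdiff := Complex.differentiableOn_update_limUnder_of_bddAbove hball
    (fun z hz => (hFan z hz.2).differentiableAt.differentiableWithinAt) (f := F) (c := 0)
    ⟨C, by
      rintro _ ⟨z, ⟨hz1, hz2⟩, rfl⟩
      have hz : 0 < ‖z‖ := norm_pos_iff.2 hz2
      obtain ⟨j, hj⟩ := pow_unbounded_of_one_lt ‖z‖⁻¹ hQ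
      exact hbound j z (by rw [mul_comm]; exact (inv_le_iff_one_le_mul₀ hz).1 hj.le)
        (by simpa using hz1)⟩
  have hzero := (hdiff.analyticAt hball).eventually_eq_zero_of_dilation (ν := Q ^ N * μ)
    (fun m h => hμ (m - N : ℤ) (by
      rw [zpow_sub₀ hQ0, zpow_natCast, zpow_natCast, h]; field_simp))
    (eventually_mem_nhdsWithin.mono fun z hz => by
      have hz : z ≠ 0 := hz
      rw [update_of_ne hz, update_of_ne (mul_ne_zero hQ0 hz), hFfe z hz])
  have hpow : ∀ (j : ℕ) (z : ℂ), z ≠ 0 → f z = μ ^ j * f (z * Q⁻¹ ^ j) := by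
    intro j
    induction j with
    | zero => simp
    | succ j ih =>
      intro z hz
      have hz' : z * Q⁻¹ ^ (j + 1) ≠ 0 := mul_ne_zero hz (pow_ne_zero _ (inv_ne_zero hQ0))
      have h : Q * (z * Q⁻¹ ^ (j + 1)) = z * Q⁻¹ ^ j := by
        rw [pow_succ]; field_simp
      rw [ih z hz, pow_succ μ, mul_assoc, ← hfe _ hz', h]
  intro z hz
  have ht : Tendsto (fun j : ℕ => z * Q⁻¹ ^ j) atTop (𝓝 0) := by
    have hr : ‖Q⁻¹‖ < 1 := by rw [norm_inv]; exact inv_lt_one_of_one_lt₀ hQ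
    simpa using (tendsto_pow_atTop_nhds_zero_of_norm_lt_one hr).const_mul z
  obtain ⟨j, hj⟩ := (ht.eventually hzero).exists
  have hz' : z * Q⁻¹ ^ j ≠ 0 := mul_ne_zero hz (pow_ne_zero _ (inv_ne_zero hQ0))
  rw [update_of_ne hz'] at hj
  rw [hpow j z hz, (mul_eq_zero.1 hj).resolve_left (pow_ne_zero _ hz'), mul_zero]

/-- Removing singularities: some `f` is analytic at every point where `f₀` agrees, on a punctured
neighbourhood, with an analytic function, and `f` agrees with `f₀` near such a point. -/
lemma exists_analyticAt_of_removable {f₀ : ℂ → ℂ} :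
    ∃ f : ℂ → ℂ, ∀ z₀, (∃ G, AnalyticAt ℂ G z₀ ∧ f₀ =ᶠ[𝓝[≠] z₀] G) →
      AnalyticAt ℂ f z₀ ∧ f =ᶠ[𝓝[≠] z₀] f₀ := by
  refine ⟨fun z => limUnder (𝓝[≠] z) f₀, fun z₀ ⟨G, hG, hfG⟩ => ?_⟩
  have key : ∀ z, ContinuousAt G z → f₀ =ᶠ[𝓝[≠] z] G → limUnder (𝓝[≠] z) f₀ = G z :=
    fun z hc he => ((hc.tendsto.mono_left nhdsWithin_le_nhds).congr' he.symm).limUnder_eq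
  have h1 : ∀ᶠ z in 𝓝[≠] z₀, f₀ =ᶠ[𝓝[≠] z] G := by
    filter_upwards [eventually_eventually_nhdsWithin.2 hfG, self_mem_nhdsWithin] with z hz hne
    rw [(isOpen_compl_singleton).nhdsWithin_eq hne] at hz
    exact hz.filter_mono nhdsWithin_le_nhds
  have h2 : ∀ᶠ z in 𝓝[≠] z₀, limUnder (𝓝[≠] z) f₀ = G z := by
    filter_upwards [h1, nhdsWithin_le_nhds hG.eventually_continuousAt] with z h h'
    exact key z h' h
  have h3 : (fun z => limUnder (𝓝[≠] z) f₀) =ᶠ[𝓝 z₀] G := by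
    rw [← nhdsNE_sup_pure]
    exact eventually_sup.2 ⟨h2, key z₀ hG.continuousAt hfG⟩
  exact ⟨hG.congr h3.symm, (h3.filter_mono nhdsWithin_le_nhds).trans hfG.symm⟩

/-- A theta function for `Q`, rescaled so that it vanishes on the spiral `-λ Q^ℤ`. -/
lemma exists_theta_spiral {Q lam : ℂ} (hQ : 1 < ‖Q‖) (hlam : lam ≠ 0) :
    ∃ θ : ℂ → ℂ, (∀ z, z ≠ 0 → AnalyticAt ℂ θ z) ∧
      (∀ z, z ≠ 0 → lam * θ (Q * z) = z * θ z) ∧ (∀ k : ℤ, θ (-lam * Q ^ k) = 0) ∧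
      ∀ z, z ≠ 0 → ∀ᶠ w in 𝓝[≠] z, θ w ≠ 0 := by
  have hQ0 : Q ≠ 0 := norm_pos_iff.1 (by linarith)
  have hinv : lam⁻¹ ≠ 0 := inv_ne_zero hlam
  obtain ⟨θ, han, hfe, h1, hne⟩ := exists_theta hQ
  refine ⟨fun z => θ (lam⁻¹ * z), fun z hz => ?_, fun z hz => ?_, fun k => ?_, fun z hz => ?_⟩
  · exact (han _ (mul_ne_zero hinv hz)).fun_comp (by fun_prop)
  · simp only
    rw [mul_left_comm, hfe _ (mul_ne_zero hinv hz)]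
    field_simp
  · have h : ∀ k : ℤ, θ (-Q ^ k) = 0 := fun k => by
      have hstep : ∀ k : ℤ, θ (-Q ^ (k + 1)) = -Q ^ k * θ (-Q ^ k) := fun k => by
        rw [← hfe _ (neg_ne_zero.2 (zpow_ne_zero k hQ0)), zpow_add_one₀ hQ0]
        congr 1; ring
      induction k using Int.induction_on with
      | zero => simpa using h1
      | succ k ih => rw [hstep, ih, mul_zero]
      | pred k ih =>
        have := hstep (-k - 1)
        rw [sub_add_cancel, ih] at this
        exact (mul_eq_zero.1 this.symm).resolve_left (neg_ne_zero.2 (zpow_ne_zero _ hQ0))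
    rw [← h k]
    field_simp
  · exact (tendsto_const_mul_nhdsNE hinv z).eventually (hne _ (mul_ne_zero hinv hz))


/-- Uniqueness of the meromorphic solution of `c z^n y(q^d z) = a y(z) - b(z)` with poles
contained in `-λ q^{dℤ}` of order at most `n`, when `c λ^n ∉ a q^{dℤ}`. -/
theorem meromorphic_solution_unique (q : ℂ) (hq : 1 < ‖q‖) (n d : ℕ) (hn : 1 ≤ n)
    (hd : 1 ≤ d) (a c : ℂ) (ha : a ≠ 0) (hc : c ≠ 0) (lam : ℂ) (hlam : lam ≠ 0)
    (hreg : ∀ k : ℤ, c * lam ^ n * q ^ (d * k) ≠ a)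
    (b y₁ y₂ : ℂ → ℂ) (hb : ∀ z : ℂ, z ≠ 0 → MeromorphicAt b z)
    (hy₁an : ∀ z : ℂ, z ≠ 0 → (∀ k : ℤ, z ≠ -lam * q ^ (d * k)) → AnalyticAt ℂ y₁ z)
    (hy₂an : ∀ z : ℂ, z ≠ 0 → (∀ k : ℤ, z ≠ -lam * q ^ (d * k)) → AnalyticAt ℂ y₂ z)
    (hy₁pole : ∀ z₀ : ℂ, z₀ ≠ 0 → (∃ k : ℤ, z₀ = -lam * q ^ (d * k)) →
      ∃ g : ℂ → ℂ, AnalyticAt ℂ g z₀ ∧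
        ∀ᶠ z in nhdsWithin z₀ {z₀}ᶜ, y₁ z = g z / (z - z₀) ^ n)
    (hy₂pole : ∀ z₀ : ℂ, z₀ ≠ 0 → (∃ k : ℤ, z₀ = -lam * q ^ (d * k)) →
      ∃ g : ℂ → ℂ, AnalyticAt ℂ g z₀ ∧
        ∀ᶠ z in nhdsWithin z₀ {z₀}ᶜ, y₂ z = g z / (z - z₀) ^ n)
    (heq₁ : ∀ z : ℂ, z ≠ 0 → (∀ k : ℤ, z ≠ -lam * q ^ (d * k)) → AnalyticAt ℂ b z →
      c * z ^ n * y₁ (q ^ d * z) = a * y₁ z - b z)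
    (heq₂ : ∀ z : ℂ, z ≠ 0 → (∀ k : ℤ, z ≠ -lam * q ^ (d * k)) → AnalyticAt ℂ b z →
      c * z ^ n * y₂ (q ^ d * z) = a * y₂ z - b z) :
    ∀ z : ℂ, z ≠ 0 → (∀ k : ℤ, z ≠ -lam * q ^ (d * k)) → y₁ z = y₂ z := by
  set Q : ℂ := q ^ d with hQdef
  have hspi : ∀ k : ℤ, q ^ (d * k) = Q ^ k := fun k => by rw [zpow_mul, zpow_natCast]
  simp only [hspi] at *
  have hQ : 1 < ‖Q‖ := by rw [hQdef, norm_pow]; exact one_lt_pow₀ hq (by lia)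
  have hQ0 : Q ≠ 0 := norm_pos_iff.1 (by linarith)
  obtain ⟨θ, hθan, hθfe, hθ0, hθne⟩ := exists_theta_spiral hQ hlam
  have hoff : ∀ z, θ z ≠ 0 → ∀ k : ℤ, z ≠ -lam * Q ^ k := by
    rintro _ hz k rfl
    exact hz (hθ0 k)
  obtain ⟨f, hf⟩ := exists_analyticAt_of_removable (f₀ := fun z => (y₁ z - y₂ z) * θ z ^ n)
  have hrem : ∀ z₀, z₀ ≠ 0 →
      ∃ G, AnalyticAt ℂ G z₀ ∧ (fun z => (y₁ z - y₂ z) * θ z ^ n) =ᶠ[𝓝[≠] z₀] G := by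
    intro z₀ hz₀
    by_cases hs : ∃ k : ℤ, z₀ = -lam * Q ^ k
    · obtain ⟨g₁, hg₁, he₁⟩ := hy₁pole z₀ hz₀ hs
      obtain ⟨g₂, hg₂, he₂⟩ := hy₂pole z₀ hz₀ hs
      have hz : θ z₀ = 0 := by obtain ⟨k, rfl⟩ := hs; exact hθ0 k
      have hord : ((1 : ℕ) : ℕ∞) ≤ analyticOrderAt θ z₀ := by
        rw [Nat.cast_one, Order.one_le_iff_ne_zero, (hθan z₀ hz₀).analyticOrderAt_ne_zero]
        exact hz
      obtain ⟨t, ht, het⟩ := (natCast_le_analyticOrderAt (hθan z₀ hz₀)).1 hord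
      refine ⟨fun z => (g₁ z - g₂ z) * t z ^ n, (hg₁.sub hg₂).mul (ht.pow n), ?_⟩
      filter_upwards [he₁, he₂, nhdsWithin_le_nhds het, self_mem_nhdsWithin] with z h1 h2 h3 h4
      have : (z - z₀) ^ n ≠ 0 := pow_ne_zero _ (sub_ne_zero.2 h4)
      rw [h1, h2, h3, pow_one, smul_eq_mul, mul_pow]
      field_simp
    · push Not at hs
      exact ⟨_, ((hy₁an z₀ hz₀ hs).sub (hy₂an z₀ hz₀ hs)).mul ((hθan z₀ hz₀).pow n), .rfl⟩
  have hfan : ∀ z, z ≠ 0 → AnalyticAt ℂ f z := fun z hz => (hf z (hrem z hz)).1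
  have hfeq : ∀ z, z ≠ 0 → ∀ᶠ w in 𝓝[≠] z, f w = (y₁ w - y₂ w) * θ w ^ n :=
    fun z hz => (hf z (hrem z hz)).2
  have hffe : ∀ z, z ≠ 0 → f (Q * z) = a / (c * lam ^ n) * f z := by
    intro z hz
    have hQz : Q * z ≠ 0 := mul_ne_zero hQ0 hz
    have c1 : ContinuousAt (fun w => f (Q * w)) z :=
      ContinuousAt.comp' (hfan _ hQz).continuousAt (by fun_prop)
    have c2 : ContinuousAt (fun w => a / (c * lam ^ n) * f w) z :=
      continuousAt_const.mul (hfan _ hz).continuousAt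
    refine ((c1.eventuallyEq_nhds_iff_eventuallyEq_nhdsNE c2).1 ?_).eq_of_nhds
    filter_upwards [hfeq z hz, (tendsto_const_mul_nhdsNE hQ0 z).eventually (hfeq _ hQz),
      hθne z hz, (hb z hz).eventually_analyticAt,
      nhdsWithin_le_nhds (isOpen_ne.mem_nhds hz)] with w h1 h2 h3 h4 h5
    have hw : w ≠ 0 := h5
    have e1 := heq₁ w hw (hoff w h3) h4
    have e2 := heq₂ w hw (hoff w h3) h4
    have e3 : lam ^ n * θ (Q * w) ^ n = w ^ n * θ w ^ n := by
      rw [← mul_pow, hθfe w hw, mul_pow]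
    have hcl : c * lam ^ n ≠ 0 := mul_ne_zero hc (pow_ne_zero _ hlam)
    rw [h1, h2, div_mul_eq_mul_div, eq_div_iff hcl]
    linear_combination (c * (y₁ (Q * w) - y₂ (Q * w))) * e3 + θ w ^ n * (e1 - e2)
  have hf0 := eq_zero_of_dilation hQ (μ := a / (c * lam ^ n))
    (div_ne_zero ha (mul_ne_zero hc (pow_ne_zero _ hlam)))
    (fun m h => hreg m (by rw [h]; field_simp)) hfan hffe
  intro z hz hs
  refine (((hy₁an z hz hs).continuousAt.eventuallyEq_nhds_iff_eventuallyEq_nhdsNE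
    (hy₂an z hz hs).continuousAt).1 ?_).eq_of_nhds
  filter_upwards [hfeq z hz, hθne z hz, nhdsWithin_le_nhds (isOpen_ne.mem_nhds hz)]
    with w h1 h2 h3
  rw [hf0 w h3] at h1
  exact sub_eq_zero.1 ((mul_eq_zero.1 h1.symm).resolve_right (pow_ne_zero _ h2))
end
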